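/- Let (Ω, ℙ) be a probability space, S a nonempty finite set, and let V, V̂ : Ω → S be measurable random variables. Then the conditional Shannon entropy satisfies H[V | V̂] ≤ log 2 + ℙ[V ≠ V̂] · log |S|. -/

import Mathlib

open MeasureTheory Real

/-- Conditional Shannon entropy `H[V | W]` (natural logarithm) of random variables
with values in the finite type `S`. -/
noncomputable def shannonCondEntropy {Ω S : Type*} [MeasurableSpace Ω] [Fintype S]
    (ℙ : Measure Ω) (V W : Ω → S) : ℝ :=
  -∑ v : S, ∑ w : S,
    (ℙ (V ⁻¹' {v} ∩ W ⁻¹' {w})).toReal *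
      Real.log ((ℙ (V ⁻¹' {v} ∩ W ⁻¹' {w})).toReal / (ℙ (W ⁻¹' {w})).toReal)

/-- Pointwise form of Gibbs' inequality. -/
lemma neg_mul_log_div_le {p q r : ℝ} (hp : 0 ≤ p) (hpq : p ≤ q) (hr : 0 < r) :
    -(p * log (p / q)) ≤ p * -log r + q * r - p := by
  rcases hp.eq_or_lt with rfl | hp
  · simpa using mul_nonneg hpq hr.le
  have hq : 0 < q := hp.trans_le hpq
  have h := mul_le_mul_of_nonneg_left
    (log_le_sub_one_of_pos (div_pos (mul_pos hq hr) hp)) hp.le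
  rw [log_div (mul_pos hq hr).ne' hp.ne', log_mul hq.ne' hr.ne', mul_sub p (_ / _),
    mul_div_cancel₀ _ hp.ne'] at h
  rw [log_div hp.ne' hq.ne']
  linarith

/-- The fibres of a random variable with finitely many values partition every event. -/
lemma sum_toReal_measure_preimage_singleton_inter {Ω S : Type*} [MeasurableSpace Ω] [Fintype S]
    [MeasurableSpace S] [MeasurableSingletonClass S] (μ : Measure Ω) [IsFiniteMeasure μ]
    {V : Ω → S} (hV : Measurable V) (B : Set Ω) :
    ∑ v, (μ (V ⁻¹' {v} ∩ B)).toReal = (μ B).toReal := by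
  have hm (v : S) : MeasurableSet (V ⁻¹' {v}) := hV (measurableSet_singleton v)
  rw [← ENNReal.toReal_sum fun _ _ => measure_ne_top _ _]
  congr 1
  simp_rw [← Measure.restrict_apply (hm _)]
  rw [sum_measure_preimage_singleton _ fun v _ => hm v]
  simp

/-- **Weakened Fano inequality.**
For random variables `V, V̂` with values in a nonempty finite set `S`,
`H[V | V̂] ≤ log 2 + ℙ[V ≠ V̂] · log |S|`. -/
theorem weak_fano_inequality
    {Ω S : Type*} [MeasurableSpace Ω] [Fintype S] [Nonempty S]
    [MeasurableSpace S] [MeasurableSingletonClass S]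
    (ℙ : Measure Ω) [IsProbabilityMeasure ℙ]
    (V Vhat : Ω → S) (hV : Measurable V) (hVhat : Measurable Vhat) :
    shannonCondEntropy ℙ V Vhat ≤
      Real.log 2 + (ℙ {ω | V ω ≠ Vhat ω}).toReal * Real.log (Fintype.card S) := by
  classical
  set n : ℝ := (Fintype.card S : ℝ) with hn
  have hn0 : 0 < n := by simp [hn, Fintype.card_pos]
  set p : S → S → ℝ := fun v w => (ℙ (V ⁻¹' {v} ∩ Vhat ⁻¹' {w})).toReal with hp
  set q : S → ℝ := fun w => (ℙ (Vhat ⁻¹' {w})).toReal with hq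
  let r : S → S → ℝ := fun v w => if v = w then 1 / 2 else 1 / (2 * n)
  have hr (v w : S) : 0 < r v w := by
    dsimp only [r]; split_ifs <;> positivity
  have hlog (v w : S) : -log (r v w) = log 2 + if v = w then 0 else log n := by
    dsimp only [r]
    split_ifs
    · simp
    · rw [one_div, log_inv, neg_neg, log_mul two_ne_zero hn0.ne']
  have hpq (w : S) : ∑ v, p v w = q w :=
    sum_toReal_measure_preimage_singleton_inter ℙ hV _
  have hq1 : ∑ w, q w = 1 := by
    simpa using sum_toReal_measure_preimage_singleton_inter ℙ hVhat Set.univ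
  have hp1 : ∑ v, ∑ w, p v w = 1 := by
    rw [Finset.sum_comm]; simp_rw [hpq, hq1]
  have herr : ∑ v, ∑ w, (if v = w then 0 else p v w) = (ℙ {ω | V ω ≠ Vhat ω}).toReal := by
    rw [← sum_toReal_measure_preimage_singleton_inter ℙ hV]
    refine Finset.sum_congr rfl fun v _ => ?_
    rw [← sum_toReal_measure_preimage_singleton_inter ℙ hVhat]
    refine Finset.sum_congr rfl fun w _ => ?_
    split_ifs with h
    · subst h
      have : Vhat ⁻¹' {v} ∩ (V ⁻¹' {v} ∩ {ω | V ω ≠ Vhat ω}) = ∅ := by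
        ext ω; simp; grind
      simp [this]
    · have : Vhat ⁻¹' {w} ∩ (V ⁻¹' {v} ∩ {ω | V ω ≠ Vhat ω}) = V ⁻¹' {v} ∩ Vhat ⁻¹' {w} := by
        ext ω; simp; grind
      simp [this, hp]
  have hr1 (w : S) : ∑ v, r v w ≤ 1 := by
    calc ∑ v, r v w ≤ ∑ v, ((if v = w then 1 / 2 else 0) + 1 / (2 * n)) := by
          refine Finset.sum_le_sum fun v _ => ?_
          dsimp only [r]
          split_ifs
          · exact le_add_of_nonneg_right (by positivity)
          · simp
      _ = 1 := by
          rw [Finset.sum_add_distrib, Finset.sum_ite_eq' Finset.univ w]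
          simp only [Finset.mem_univ, if_true, Finset.sum_const, Finset.card_univ, nsmul_eq_mul]
          rw [← hn]
          field_simp
          norm_num
  have hqr : ∑ v, ∑ w, q w * r v w ≤ 1 := by
    rw [Finset.sum_comm, ← hq1]
    refine Finset.sum_le_sum fun w _ => ?_
    rw [← Finset.mul_sum]
    exact mul_le_of_le_one_right ENNReal.toReal_nonneg (hr1 w)
  calc shannonCondEntropy ℙ V Vhat
      = ∑ v, ∑ w, -(p v w * log (p v w / q w)) := by
        simp only [shannonCondEntropy, Finset.sum_neg_distrib, hp, hq]
    _ ≤ ∑ v, ∑ w, (p v w * -log (r v w) + q w * r v w - p v w) := by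
        refine Finset.sum_le_sum fun v _ => Finset.sum_le_sum fun w _ => ?_
        exact neg_mul_log_div_le ENNReal.toReal_nonneg
          (ENNReal.toReal_mono (measure_ne_top _ _) (measure_mono Set.inter_subset_right)) (hr v w)
    _ = ∑ v, ∑ w, (p v w * log 2 + (if v = w then 0 else p v w) * log n
          + q w * r v w - p v w) := by
        refine Finset.sum_congr rfl fun v _ => Finset.sum_congr rfl fun w _ => ?_
        rw [hlog]
        split_ifs <;> ring
    _ = log 2 + (ℙ {ω | V ω ≠ Vhat ω}).toReal * log n + ∑ v, ∑ w, q w * r v w - 1 := by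
        simp only [Finset.sum_add_distrib, Finset.sum_sub_distrib, ← Finset.sum_mul, herr, hp1,
          one_mul]
    _ ≤ log 2 + (ℙ {ω | V ω ≠ Vhat ω}).toReal * log n := by linarith
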